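/- arXiv:2309.02327 — 2 statements merged into one kernel-verified Lean document; each statement's English description precedes it below -/
import Mathlib

section
/- Let (K, δ) be a differential commutative ring, let n, e be natural numbers, and let f₁, …, f_e ∈ K[x₁, …, x_n]. For a polynomial f ∈ K[x₁, …, x_n], let δ(f) ∈ K[x₁, …, x_n, ẋ₁, …, ẋ_n] denote its total derivative, obtained by applying δ to each coefficient of f and adding Σ_{i=1}^{n} (∂f/∂x_i)·ẋ_i. Set A = K[x₁, …, x_n]/(f₁, …, f_e) and A¹ = K[x₁, …, x_n, ẋ₁, …, ẋ_n]/(f₁, …, f_e, δ(f₁), …, δ(f_e)), with the canonical ring map A → A¹. Then there exists a unique additive map d : A → A¹ which satisfies the Leibniz rule along A → A¹ (i.e. d(ab) = ā·d(b) + b̄·d(a), where ā denotes the image of a in A¹), maps the class of each constant c ∈ K to the class of δ(c), and maps the class of x_i to the class of ẋ_i for each i. -/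
open MvPolynomial

/-- The total derivative of a polynomial `f ∈ K[x₁, …, xₙ]` relative to a derivation
`δ` on the coefficients: the polynomial `f^δ + Σᵢ (∂f/∂xᵢ)·ẋᵢ` in
`K[x₁, …, xₙ, ẋ₁, …, ẋₙ]`, where `f^δ` applies `δ` to each coefficient of `f`.
The variables `xᵢ` are indexed by `Sum.inl i` and the `ẋᵢ` by `Sum.inr i`. -/
noncomputable def totalDeriv {K : Type*} [CommRing K] (δ : K → K) {n : ℕ}
    (p : MvPolynomial (Fin n) K) : MvPolynomial (Fin n ⊕ Fin n) K :=
  rename Sum.inl (∑ m ∈ p.support, monomial m (δ (p.coeff m))) +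
    ∑ i : Fin n, rename Sum.inl (pderiv i p) * X (Sum.inr i)

/-- The ideal `(f₁, …, f_e, δ(f₁), …, δ(f_e))` of `K[x₁, …, xₙ, ẋ₁, …, ẋₙ]` defining
the first jet ring `A¹` of `A = K[x₁, …, xₙ]/(f₁, …, f_e)`. -/
noncomputable def jetIdeal {K : Type*} [CommRing K] (δ : K → K) {n e : ℕ}
    (f : Fin e → MvPolynomial (Fin n) K) : Ideal (MvPolynomial (Fin n ⊕ Fin n) K) :=
  Ideal.span (Set.range (fun j => rename Sum.inl (f j)) ∪
    Set.range (fun j => totalDeriv δ (f j)))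

theorem coeff_cpart {K : Type*} [CommRing K] (D : K →+ K) {n : ℕ}
    (p : MvPolynomial (Fin n) K) (k : Fin n →₀ ℕ) :
    coeff k (∑ m ∈ p.support, monomial m (D (p.coeff m))) = D (p.coeff k) := by
  classical
  rw [coeff_sum]
  simp only [coeff_monomial]
  rw [Finset.sum_ite_eq' p.support k]
  split_ifs with h
  · rfl
  · rw [notMem_support_iff.mp h, map_zero]

theorem totalDeriv_add' {K : Type*} [CommRing K] (D : K →+ K) {n : ℕ}
    (p q : MvPolynomial (Fin n) K) :
    totalDeriv D (p + q) = totalDeriv D p + totalDeriv D q := by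
  have h : (∑ m ∈ (p + q).support, monomial m (D ((p + q).coeff m))) =
      (∑ m ∈ p.support, monomial m (D (p.coeff m))) +
      (∑ m ∈ q.support, monomial m (D (q.coeff m))) := by
    ext k
    rw [coeff_add, coeff_cpart, coeff_cpart, coeff_cpart, coeff_add, map_add]
  unfold totalDeriv
  rw [h]
  simp only [map_add, add_mul, Finset.sum_add_distrib]
  abel

theorem totalDeriv_mul' {K : Type*} [CommRing K] (D : K →+ K)
    (hD : ∀ a b, D (a * b) = D a * b + a * D b) {n : ℕ}
    (p q : MvPolynomial (Fin n) K) :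
    totalDeriv D (p * q) =
      rename Sum.inl p * totalDeriv D q + rename Sum.inl q * totalDeriv D p := by
  classical
  have h : (∑ m ∈ (p * q).support, monomial m (D ((p * q).coeff m))) =
      (∑ m ∈ p.support, monomial m (D (p.coeff m))) * q +
      p * (∑ m ∈ q.support, monomial m (D (q.coeff m))) := by
    ext k
    rw [coeff_add, coeff_cpart, coeff_mul, coeff_mul, coeff_mul, map_sum,
      ← Finset.sum_add_distrib]
    refine Finset.sum_congr rfl fun x _ => ?_
    rw [coeff_cpart, coeff_cpart, hD]
  have h2 : ∑ i : Fin n, rename Sum.inl (pderiv i (p * q)) *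
        (X (Sum.inr i) : MvPolynomial (Fin n ⊕ Fin n) K) =
      rename Sum.inl p * ∑ i : Fin n, rename Sum.inl (pderiv i q) * X (Sum.inr i) +
      rename Sum.inl q * ∑ i : Fin n, rename Sum.inl (pderiv i p) * X (Sum.inr i) := by
    rw [Finset.mul_sum, Finset.mul_sum, ← Finset.sum_add_distrib]
    refine Finset.sum_congr rfl fun i _ => ?_
    rw [Derivation.leibniz]
    simp only [smul_eq_mul, map_add, map_mul]
    ring
  unfold totalDeriv
  rw [h, h2, map_add, map_mul, map_mul]
  ring

theorem totalDeriv_C' {K : Type*} [CommRing K] (D : K →+ K) {n : ℕ} (c : K) :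
    totalDeriv D (C c : MvPolynomial (Fin n) K) = C (D c) := by
  classical
  have h : (∑ m ∈ (C c : MvPolynomial (Fin n) K).support,
      monomial m (D ((C c : MvPolynomial (Fin n) K).coeff m))) = C (D c) := by
    ext k
    rw [coeff_cpart, coeff_C, coeff_C]
    split_ifs <;> simp
  unfold totalDeriv
  rw [h]
  simp

theorem totalDeriv_X' {K : Type*} [CommRing K] (D : K →+ K) (h1 : D 1 = 0) {n : ℕ}
    (i : Fin n) :
    totalDeriv D (X i : MvPolynomial (Fin n) K) = X (Sum.inr i) := by
  classical
  have h : (∑ m ∈ (X i : MvPolynomial (Fin n) K).support,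
      monomial m (D ((X i : MvPolynomial (Fin n) K).coeff m))) = 0 := by
    ext k
    rw [coeff_cpart, coeff_X, coeff_zero]
    split_ifs <;> simp [h1]
  unfold totalDeriv
  rw [h, Finset.sum_eq_single i]
  · simp
  · intro j _ hj
    rw [pderiv_X_of_ne hj.symm]
    simp
  · simp

/-- Let `(K, δ)` be a differential ring, `A = K[x₁, …, xₙ]/(f₁, …, f_e)` and
`A¹ = K[x₁, …, xₙ, ẋ₁, …, ẋₙ]/(f₁, …, f_e, δ(f₁), …, δ(f_e))`, with canonical ring map
`ψ : A → A¹` (induced by `xᵢ ↦ xᵢ`). Then there is a unique additive map `d : A → A¹`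
satisfying the Leibniz rule along `ψ`, sending the class of each constant `c ∈ K` to
the class of `δ(c)` and the class of each `xᵢ` to the class of `ẋᵢ`. -/
theorem stmt4 {K : Type*} [CommRing K] (δ : K → K)
    (hδadd : ∀ a b, δ (a + b) = δ a + δ b)
    (hδmul : ∀ a b, δ (a * b) = δ a * b + a * δ b)
    (n e : ℕ) (f : Fin e → MvPolynomial (Fin n) K)
    (ψ : (MvPolynomial (Fin n) K ⧸ Ideal.span (Set.range f)) →+*
      (MvPolynomial (Fin n ⊕ Fin n) K ⧸ jetIdeal δ f))
    (hψ : ∀ p : MvPolynomial (Fin n) K,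
      ψ (Ideal.Quotient.mk (Ideal.span (Set.range f)) p) =
        Ideal.Quotient.mk (jetIdeal δ f) (rename Sum.inl p)) :
    ∃! d : (MvPolynomial (Fin n) K ⧸ Ideal.span (Set.range f)) →
        (MvPolynomial (Fin n ⊕ Fin n) K ⧸ jetIdeal δ f),
      (∀ a b, d (a + b) = d a + d b) ∧
      (∀ a b, d (a * b) = ψ a * d b + ψ b * d a) ∧
      (∀ c : K, d (Ideal.Quotient.mk (Ideal.span (Set.range f)) (C c)) =
        Ideal.Quotient.mk (jetIdeal δ f) (C (δ c))) ∧
      (∀ i : Fin n, d (Ideal.Quotient.mk (Ideal.span (Set.range f)) (X i)) =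
        Ideal.Quotient.mk (jetIdeal δ f) (X (Sum.inr i))) := by
  obtain ⟨D, rfl⟩ : ∃ D : K →+ K, δ = D := ⟨AddMonoidHom.mk' δ hδadd, rfl⟩
  have h1 : D 1 = 0 := by
    have := hδmul 1 1
    simpa using this
  set I := Ideal.span (Set.range f) with hI
  set J := jetIdeal D f with hJ
  have hsub : ∀ p q : MvPolynomial (Fin n) K,
      totalDeriv D (p - q) = totalDeriv D p - totalDeriv D q := by
    intro p q
    rw [eq_sub_iff_add_eq, ← totalDeriv_add', sub_add_cancel]
  have hz : totalDeriv D (0 : MvPolynomial (Fin n) K) = 0 := by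
    have := hsub 0 0
    simpa using this
  have key : ∀ p ∈ I, rename Sum.inl p ∈ J ∧ totalDeriv D p ∈ J := by
    intro p hp
    induction hp using Submodule.span_induction with
    | mem x hx =>
      obtain ⟨j, rfl⟩ := hx
      exact ⟨Ideal.subset_span (Or.inl ⟨j, rfl⟩), Ideal.subset_span (Or.inr ⟨j, rfl⟩)⟩
    | zero => rw [hz, map_zero]; exact ⟨J.zero_mem, J.zero_mem⟩
    | add x y _ _ hx hy =>
      rw [totalDeriv_add', map_add]
      exact ⟨J.add_mem hx.1 hy.1, J.add_mem hx.2 hy.2⟩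
    | smul a x _ hx =>
      rw [smul_eq_mul, totalDeriv_mul' D hδmul, map_mul]
      exact ⟨J.mul_mem_left _ hx.1,
        J.add_mem (J.mul_mem_left _ hx.2) (J.mul_mem_right _ hx.1)⟩
  have hs : Function.Surjective (Ideal.Quotient.mk I) := Ideal.Quotient.mk_surjective
  obtain ⟨d, hd⟩ : ∃ d : (MvPolynomial (Fin n) K ⧸ I) → (MvPolynomial (Fin n ⊕ Fin n) K ⧸ J),
      ∀ p, d (Ideal.Quotient.mk I p) = Ideal.Quotient.mk J (totalDeriv D p) := by
    refine ⟨fun a => Ideal.Quotient.mk J (totalDeriv D (Function.surjInv hs a)), fun p => ?_⟩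
    rw [Ideal.Quotient.eq, ← hsub]
    refine (key _ ?_).2
    rw [← Ideal.Quotient.eq, Function.surjInv_eq hs]
  refine ⟨d, ⟨?_, ?_, ?_, ?_⟩, ?_⟩
  · intro a b
    obtain ⟨p, rfl⟩ := hs a
    obtain ⟨q, rfl⟩ := hs b
    rw [← map_add, hd, hd, hd, totalDeriv_add', map_add]
  · intro a b
    obtain ⟨p, rfl⟩ := hs a
    obtain ⟨q, rfl⟩ := hs b
    rw [← map_mul, hd, hd, hd, hψ, hψ, totalDeriv_mul' D hδmul, map_add, map_mul, map_mul]
  · intro c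
    rw [hd, totalDeriv_C']
  · intro i
    rw [hd, totalDeriv_X' D h1]
  · rintro d' ⟨ha, hm, hc, hx⟩
    funext a
    obtain ⟨p, rfl⟩ := hs a
    induction p using MvPolynomial.induction_on with
    | C c => rw [hc, hd, totalDeriv_C']
    | add p q hp hq => rw [hd (p + q), map_add, ha, hp, hq, hd, hd, totalDeriv_add', map_add]
    | mul_X p i hp =>
      rw [hd (p * X i), map_mul, hm, hp, hx, hd, hψ, hψ, totalDeriv_mul' D hδmul,
        totalDeriv_X' D h1, map_add, map_mul, map_mul]
end

section
/- Let (K, δ) be a differential commutative ring and let F, α, β, γ ∈ K[x, y] be polynomials satisfying α·(∂F/∂x) + β·(∂F/∂y) + γ·F = 1. Let F^δ ∈ K[x, y] denote the polynomial obtained by applying δ to each coefficient of F. Then there exists a prolongation D of δ to the quotient ring A = K[x, y]/(F) (i.e. an additive map D : A → A satisfying the Leibniz rule with D(c̄) = δ(c) for the class c̄ of every constant c ∈ K) such that D sends the class of x to the class of −F^δ·α and the class of y to the class of −F^δ·β. -/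
open MvPolynomial

/-- The polynomial `F^δ` obtained by applying `δ` to each coefficient of `F`. -/
noncomputable def coeffDeriv {K : Type*} [CommRing K] (δ : K → K)
    (p : MvPolynomial (Fin 2) K) : MvPolynomial (Fin 2) K :=
  ∑ m ∈ p.support, monomial m (δ (p.coeff m))

theorem coeffDeriv_coeff_aux {K : Type*} [CommRing K] (d : K →+ K)
    (p : MvPolynomial (Fin 2) K) (m : Fin 2 →₀ ℕ) :
    coeff m (coeffDeriv d p) = d (coeff m p) := by
  classical
  unfold coeffDeriv
  rw [coeff_sum]
  simp only [coeff_monomial]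
  rw [Finset.sum_ite_eq']
  split_ifs with h
  · rfl
  · rw [notMem_support_iff.mp h, map_zero]

theorem coeffDeriv_add_aux {K : Type*} [CommRing K] (d : K →+ K)
    (p q : MvPolynomial (Fin 2) K) :
    coeffDeriv d (p + q) = coeffDeriv d p + coeffDeriv d q := by
  ext m
  simp [coeffDeriv_coeff_aux]

theorem coeffDeriv_mul_aux {K : Type*} [CommRing K] (d : K →+ K)
    (hd : ∀ a b, d (a * b) = d a * b + a * d b)
    (p q : MvPolynomial (Fin 2) K) :
    coeffDeriv d (p * q) = coeffDeriv d p * q + p * coeffDeriv d q := by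
  classical
  ext m
  simp only [coeffDeriv_coeff_aux, coeff_mul, coeff_add, map_sum, hd, Finset.sum_add_distrib]

theorem coeffDeriv_C_aux {K : Type*} [CommRing K] (d : K →+ K) (c : K) :
    coeffDeriv d (C c) = C (d c) := by
  classical
  ext m
  simp only [coeffDeriv_coeff_aux, coeff_C]
  split_ifs <;> simp

theorem coeffDeriv_X_aux {K : Type*} [CommRing K] (d : K →+ K)
    (hd : ∀ a b, d (a * b) = d a * b + a * d b) (i : Fin 2) :
    coeffDeriv d (X i) = 0 := by
  classical
  have h1 : d 1 = 0 := by simpa using hd 1 1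
  ext m
  simp only [coeffDeriv_coeff_aux, coeff_X']
  split_ifs <;> simp [h1]

/-- Let `(K, δ)` be a differential ring and `F, α, β, γ ∈ K[x, y]` with
`α·F_x + β·F_y + γ·F = 1`. Then there is a prolongation `D` of `δ` to
`A = K[x, y]/(F)` with `D(x) = -F^δ·α` and `D(y) = -F^δ·β` (classes taken in `A`,
with `x = X 0` and `y = X 1`). -/
theorem stmt5 {K : Type*} [CommRing K] (δ : K → K)
    (hδadd : ∀ a b, δ (a + b) = δ a + δ b)
    (hδmul : ∀ a b, δ (a * b) = δ a * b + a * δ b)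
    (F α β γ : MvPolynomial (Fin 2) K)
    (hBezout : α * pderiv 0 F + β * pderiv 1 F + γ * F = 1) :
    ∃ D : (MvPolynomial (Fin 2) K ⧸ Ideal.span {F}) →
        (MvPolynomial (Fin 2) K ⧸ Ideal.span {F}),
      (∀ a b, D (a + b) = D a + D b) ∧
      (∀ a b, D (a * b) = D a * b + a * D b) ∧
      (∀ c : K, D (Ideal.Quotient.mk (Ideal.span {F}) (C c)) =
        Ideal.Quotient.mk (Ideal.span {F}) (C (δ c))) ∧
      D (Ideal.Quotient.mk (Ideal.span {F}) (X 0)) =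
        Ideal.Quotient.mk (Ideal.span {F}) (-(coeffDeriv δ F * α)) ∧
      D (Ideal.Quotient.mk (Ideal.span {F}) (X 1)) =
        Ideal.Quotient.mk (Ideal.span {F}) (-(coeffDeriv δ F * β)) := by
  obtain ⟨d, rfl⟩ : ∃ d : K →+ K, δ = d := ⟨AddMonoidHom.mk' δ hδadd, rfl⟩
  let G := coeffDeriv d F
  let E : MvPolynomial (Fin 2) K → MvPolynomial (Fin 2) K := fun p =>
    coeffDeriv d p - G * (α * pderiv 0 p + β * pderiv 1 p)
  have Eadd : ∀ p q, E (p + q) = E p + E q := by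
    intro p q
    simp only [E, coeffDeriv_add_aux, map_add]
    ring
  have Emul : ∀ p q, E (p * q) = E p * q + p * E q := by
    intro p q
    simp only [E, coeffDeriv_mul_aux d hδmul, Derivation.leibniz, smul_eq_mul]
    ring
  have EF : E F = G * γ * F := by
    change G - G * (α * pderiv 0 F + β * pderiv 1 F) = G * γ * F
    linear_combination (-G) * hBezout
  let π := Ideal.Quotient.mk (Ideal.span {F})
  have Ewd : ∀ p q, π p = π q → π (E p) = π (E q) := by
    intro p q h
    obtain ⟨r, hr⟩ := Ideal.mem_span_singleton.mp (Ideal.Quotient.eq.mp h)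
    have hp : p = q + F * r := by rw [← hr]; ring
    refine Ideal.Quotient.eq.mpr (Ideal.mem_span_singleton.mpr ⟨G * γ * r + E r, ?_⟩)
    rw [hp, Eadd, Emul, EF]
    ring
  have hs : Function.Surjective π := Ideal.Quotient.mk_surjective
  let D := fun a => π (E (Function.surjInv hs a))
  have hD : ∀ p, D (π p) = π (E p) := fun p => Ewd _ _ (Function.surjInv_eq hs _)
  refine ⟨D, ?_, ?_, ?_, ?_, ?_⟩
  · intro a b
    obtain ⟨p, rfl⟩ := hs a
    obtain ⟨q, rfl⟩ := hs b
    rw [← map_add, hD, hD, hD, Eadd, map_add]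
  · intro a b
    obtain ⟨p, rfl⟩ := hs a
    obtain ⟨q, rfl⟩ := hs b
    rw [← map_mul, hD, hD, hD, Emul, map_add, map_mul, map_mul]
  · intro c
    refine (hD _).trans (congrArg π ?_)
    simp [E, coeffDeriv_C_aux]
  · refine (hD _).trans (congrArg π ?_)
    simp [E, G, coeffDeriv_X_aux d hδmul, pderiv_X]
  · refine (hD _).trans (congrArg π ?_)
    simp [E, G, coeffDeriv_X_aux d hδmul, pderiv_X]
end
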